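/- Let R be a commutative Noetherian ring, let I, 𝔞 ⊆ R be ideals with I ∩ R° ≠ ∅ and 𝔞 ∩ R° ≠ ∅, and let t ≥ 1 be an integer. Then the Hara–Yoshida 𝔞ᵗ-integral closure of I equals the colon ideal of the integral closure of I by 𝔞ᵗ: Ī^{𝔞ᵗ} = (Ī : 𝔞ᵗ). -/

import Mathlib

open Ideal Filter
open scoped Pointwise

/-- `R°`: the set of elements of `R` not contained in any minimal prime of `R`. -/
def Rcirc (R : Type*) [CommRing R] : Set R :=
  {c | ∀ P ∈ minimalPrimes R, c ∉ P}

/-- The integral closure of an ideal `I`: elements satisfying an equation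
`x^n + r₁ x^{n-1} + ⋯ + rₙ = 0` with `rᵢ ∈ Iⁱ`. -/
def intCl {R : Type*} [CommRing R] (I : Ideal R) : Set R :=
  {x | ∃ n : ℕ, 0 < n ∧ ∃ r : ℕ → R,
    (∀ i, 1 ≤ i → i ≤ n → r i ∈ I ^ i) ∧
    x ^ n + ∑ i ∈ Finset.range n, r (i + 1) * x ^ (n - (i + 1)) = 0}

/-- The Hara–Yoshida `𝔞^t`-integral closure of `I`. -/
def HYIntCl {R : Type*} [CommRing R] (I a : Ideal R) (t : ℝ) : Set R :=
  {x | ∃ c ∈ Rcirc R, ∃ N : ℕ, ∀ n : ℕ, N ≤ n →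
    ∀ y ∈ a ^ ⌈t * (n : ℝ)⌉₊, c * x ^ n * y ∈ I ^ n}

/-- The Vraciu `𝔞^t`-integral closure of `I`. -/
def VIntCl {R : Type*} [CommRing R] (I a : Ideal R) (t : ℝ) : Set R :=
  {x | ∃ c ∈ Rcirc R, ∃ N : ℕ, ∀ n : ℕ, N ≤ n →
    ∀ y ∈ a ^ ⌈t * (n : ℝ)⌉₊, c * x ^ n * y ∈ a ^ ⌈t * (n : ℝ)⌉₊ * I ^ n}

/-- The `q`-th Frobenius bracket power `I^{[q]}`: the ideal generated by `q`-th powers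
of elements of `I`. -/
def fbp {R : Type*} [CommRing R] (I : Ideal R) (q : ℕ) : Ideal R :=
  Ideal.span ((fun x => x ^ q) '' (I : Set R))

/-- The Frobenius closure `I^F` (in characteristic `p`). -/
def frobCl {R : Type*} [CommRing R] (p : ℕ) (I : Ideal R) : Set R :=
  {x | ∃ e : ℕ, x ^ p ^ e ∈ fbp I (p ^ e)}

/-- The tight closure `I^*` (in characteristic `p`). -/
def tightCl {R : Type*} [CommRing R] (p : ℕ) (I : Ideal R) : Set R :=
  {x | ∃ c ∈ Rcirc R, ∃ E : ℕ, ∀ e : ℕ, E ≤ e → c * x ^ p ^ e ∈ fbp I (p ^ e)}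

/-- The Hara–Yoshida `𝔞^t`-Frobenius closure of `I`. -/
def HYFrobCl {R : Type*} [CommRing R] (p : ℕ) (I a : Ideal R) (t : ℝ) : Set R :=
  {x | ∃ E : ℕ, ∀ e : ℕ, E ≤ e →
    ∀ y ∈ a ^ ⌈t * (p : ℝ) ^ e⌉₊, x ^ p ^ e * y ∈ fbp I (p ^ e)}

/-- The Vraciu `𝔞^t`-Frobenius closure of `I`. -/
def VFrobCl {R : Type*} [CommRing R] (p : ℕ) (I a : Ideal R) (t : ℝ) : Set R :=
  {x | ∃ E : ℕ, ∀ e : ℕ, E ≤ e →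
    ∀ y ∈ a ^ ⌈t * (p : ℝ) ^ e⌉₊, x ^ p ^ e * y ∈ a ^ ⌈t * (p : ℝ) ^ e⌉₊ * fbp I (p ^ e)}

/-- The Hara–Yoshida `𝔞^t`-tight closure of `I`. -/
def HYTightCl {R : Type*} [CommRing R] (p : ℕ) (I a : Ideal R) (t : ℝ) : Set R :=
  {x | ∃ c ∈ Rcirc R, ∃ E : ℕ, ∀ e : ℕ, E ≤ e →
    ∀ y ∈ a ^ ⌈t * (p : ℝ) ^ e⌉₊, c * x ^ p ^ e * y ∈ fbp I (p ^ e)}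

/-- The Vraciu `𝔞^t`-tight closure of `I`. -/
def VTightCl {R : Type*} [CommRing R] (p : ℕ) (I a : Ideal R) (t : ℝ) : Set R :=
  {x | ∃ c ∈ Rcirc R, ∃ E : ℕ, ∀ e : ℕ, E ≤ e →
    ∀ y ∈ a ^ ⌈t * (p : ℝ) ^ e⌉₊, c * x ^ p ^ e * y ∈ a ^ ⌈t * (p : ℝ) ^ e⌉₊ * fbp I (p ^ e)}

/-- The `t`-th rational power of an ideal `𝔞`, for `t = num/den ∈ ℚ`. -/
def ratPow {R : Type*} [CommRing R] (a : Ideal R) (t : ℚ) : Set R :=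
  {x | x ^ t.den ∈ intCl (a ^ t.num.toNat)}

/-- `μ(𝔞)`: the minimal number of generators of the ideal `𝔞`. -/
noncomputable def mu {R : Type*} [CommRing R] (a : Ideal R) : ℕ :=
  sInf {m | ∃ s : Finset R, s.card = m ∧ Ideal.span (s : Set R) = a}

section IntegralClosure

variable {R : Type*} [CommRing R]

theorem one_mem_Rcirc : (1 : R) ∈ Rcirc R := fun P hP h ↦
  hP.1.1.ne_top ((Ideal.eq_top_iff_one P).2 h)

theorem mul_mem_Rcirc {c d : R} (hc : c ∈ Rcirc R) (hd : d ∈ Rcirc R) : c * d ∈ Rcirc R :=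
  fun P hP h ↦ (hP.1.1.mem_or_mem h).elim (hc P hP) (hd P hP)

theorem pow_mem_Rcirc {c : R} (hc : c ∈ Rcirc R) (n : ℕ) : c ^ n ∈ Rcirc R := by
  induction n with
  | zero => simpa using one_mem_Rcirc
  | succ n ih => rw [pow_succ]; exact mul_mem_Rcirc ih hc

/-- Elements of `K * (I + (z)) ^ n` are homogeneous forms in `I` and `z` with coefficients
in `K`. -/
theorem exists_eq_sum_of_mem_mul_sup_span_pow (I : Ideal R) (z : R) (n : ℕ) :
    ∀ (K : Ideal R), ∀ w ∈ K * (I ⊔ span {z}) ^ n, ∃ r : ℕ → R, (∀ i, r i ∈ K * I ^ i) ∧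
      w = ∑ i ∈ Finset.range (n + 1), r i * z ^ (n - i) := by
  induction n with
  | zero =>
    intro K w hw
    refine ⟨fun i ↦ if i = 0 then w else 0, fun i ↦ ?_, by simp⟩
    rcases i with _ | i
    · simpa using hw
    · simp
  | succ n ih =>
    intro K w hw
    have h : K * (I ⊔ span {z}) ^ (n + 1) =
        K * I * (I ⊔ span {z}) ^ n ⊔ K * (I ⊔ span {z}) ^ n * span {z} := by
      rw [← Ideal.add_eq_sup, ← Ideal.add_eq_sup]; ring
    rw [h] at hw
    obtain ⟨u, hu, v, hv, rfl⟩ := Submodule.mem_sup.1 hw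
    obtain ⟨v', hv', rfl⟩ := Ideal.mem_mul_span_singleton.1 hv
    obtain ⟨r, hr, rfl⟩ := ih (K * I) u hu
    obtain ⟨s, hs, rfl⟩ := ih K v' hv'
    refine ⟨fun i ↦ (if i ≤ n then s i else 0) + i.casesOn 0 r, fun i ↦ ?_, ?_⟩
    · refine Ideal.add_mem _ ?_ ?_
      · split_ifs
        exacts [hs i, Ideal.zero_mem _]
      · rcases i with _ | i
        · exact Ideal.zero_mem _
        · rw [pow_succ', ← mul_assoc]; exact hr i
    · simp only [add_mul, Finset.sum_add_distrib]
      rw [add_comm, Finset.sum_range_succ _ (n + 1),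
        Finset.sum_range_succ' (fun i ↦ (Nat.casesOn i 0 r : R) * z ^ (n + 1 - i)), Finset.sum_mul]
      congr 1
      · simp only [Nat.not_succ_le_self, if_false, zero_mul, add_zero]
        refine Finset.sum_congr rfl fun i hi ↦ ?_
        have hi' : i ≤ n := by simpa [Nat.lt_succ_iff] using hi
        rw [if_pos hi', mul_assoc, ← pow_succ, Nat.sub_add_comm hi']
      · simp

/-- An element `z` is integral over `I` iff `I` is a reduction of `I + (z)`. -/
theorem mem_intCl_iff {I : Ideal R} {z : R} :
    z ∈ intCl I ↔ ∃ n, z ^ (n + 1) ∈ I * (I ⊔ span {z}) ^ n := by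
  constructor
  · rintro ⟨n, hn, r, hr, h⟩
    obtain ⟨n, rfl⟩ := Nat.exists_eq_succ_of_ne_zero hn.ne'
    refine ⟨n, ?_⟩
    rw [eq_neg_of_add_eq_zero_left h]
    refine neg_mem (Ideal.sum_mem _ fun i hi ↦ ?_)
    have hi' : i ≤ n := by simpa [Nat.lt_succ_iff] using hi
    have hle : I ^ (i + 1) * (I ⊔ span {z}) ^ (n - i) ≤ I * (I ⊔ span {z}) ^ n := by
      conv_rhs => rw [← Nat.add_sub_cancel' hi', pow_add, ← mul_assoc]
      rw [pow_succ']
      gcongr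
      exact le_sup_left
    rw [Nat.succ_eq_add_one, Nat.add_sub_add_right]
    exact hle (Ideal.mul_mem_mul (hr _ (by omega) (by omega))
      (Ideal.pow_mem_pow (Ideal.mem_sup_right (mem_span_singleton_self z)) _))
  · rintro ⟨n, h⟩
    obtain ⟨r, hr, h⟩ := exists_eq_sum_of_mem_mul_sup_span_pow I z n I _ h
    refine ⟨n + 1, n.succ_pos, fun i ↦ -r (i - 1), fun i hi _ ↦ ?_, ?_⟩
    · have := hr (i - 1)
      rw [← pow_succ', Nat.sub_add_cancel hi] at this
      exact neg_mem this
    · rw [h]; simp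

theorem exists_sup_span_pow_le_of_mem_intCl {I : Ideal R} {z : R} (hz : z ∈ intCl I) :
    ∃ k, ∀ n, (I ⊔ span {z}) ^ n ≤ I ^ (n - k) := by
  obtain ⟨k, hk⟩ := mem_intCl_iff.1 hz
  set J := I ⊔ span {z} with hJ
  have key : ∀ m, m ≤ k + 1 → span {z} ^ m * J ^ (k + 1 - m) ≤ I * J ^ k ⊔ span {z} ^ (k + 1) := by
    intro m hm
    obtain ⟨d, hd⟩ := Nat.exists_eq_add_of_le hm
    induction d generalizing m with
    | zero => simp [hd]
    | succ d ih =>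
      have h1 : k + 1 - m = d + 1 := by omega
      have h2 := ih (m + 1) (by omega) (by omega)
      rw [show k + 1 - (m + 1) = d by omega] at h2
      have h3 : span {z} ^ m * J ^ (d + 1) =
          I * (span {z} ^ m * J ^ d) ⊔ span {z} ^ (m + 1) * J ^ d := by
        rw [pow_succ J, ← Ideal.add_eq_sup]
        nth_rw 2 [hJ]
        rw [← Ideal.add_eq_sup]; ring
      rw [h1, h3]
      refine sup_le (le_sup_of_le_left ?_) h2
      rw [show k = m + d by omega, pow_add]
      gcongr
      exact le_sup_right
  have hred : J ^ (k + 1) ≤ I * J ^ k := by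
    have := key 0 (by omega)
    rw [pow_zero, one_mul, Nat.sub_zero] at this
    refine this.trans (sup_le le_rfl ?_)
    rw [span_singleton_pow, span_singleton_le_iff_mem]
    exact hk
  refine ⟨k, fun n ↦ ?_⟩
  rcases le_total n k with h | h
  · simp [Nat.sub_eq_zero_of_le h]
  · obtain ⟨m, rfl⟩ := Nat.exists_eq_add_of_le h
    have : J ^ (k + m) ≤ I ^ m * J ^ k := by
      clear h
      induction m with
      | zero => simp
      | succ m ih =>
        calc J ^ (k + (m + 1)) = J ^ (k + m) * J := by rw [← add_assoc, pow_succ]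
          _ ≤ I ^ m * J ^ k * J := by gcongr
          _ = I ^ m * J ^ (k + 1) := by ring
          _ ≤ I ^ m * (I * J ^ k) := by gcongr
          _ = I ^ (m + 1) * J ^ k := by ring
    simpa using this.trans Ideal.mul_le_left

theorem sup_pow_le_pow_sub {I K L : Ideal R} {k l : ℕ} (hK : ∀ n, K ^ n ≤ I ^ (n - k))
    (hL : ∀ n, L ^ n ≤ I ^ (n - l)) (n : ℕ) : (K ⊔ L) ^ n ≤ I ^ (n - (k + l)) := by
  rw [← Ideal.add_eq_sup, add_pow, Ideal.sum_eq_sup]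
  refine Finset.sup_le fun i hi ↦ Ideal.mul_le_left.trans ?_
  have hi' : i ≤ n := by simpa [Nat.lt_succ_iff] using hi
  calc K ^ i * L ^ (n - i) ≤ I ^ (i - k) * I ^ (n - i - l) := Ideal.mul_mono (hK _) (hL _)
    _ = I ^ (i - k + (n - i - l)) := (pow_add _ _ _).symm
    _ ≤ _ := Ideal.pow_le_pow_right (by omega)

/-- A finitely generated ideal contained in the integral closure of `I` has powers that are
linearly bounded by the powers of `I`. -/
theorem exists_pow_le_of_subset_intCl {I K : Ideal R} (hK : K.FG)
    (h : (K : Set R) ⊆ intCl I) : ∃ k, ∀ n, K ^ n ≤ I ^ (n - k) := by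
  induction K, hK using Submodule.fg_induction with
  | singleton z =>
    obtain ⟨k, hk⟩ := exists_sup_span_pow_le_of_mem_intCl (h (mem_span_singleton_self z))
    exact ⟨k, fun n ↦ (Ideal.pow_right_mono le_sup_right n).trans (hk n)⟩
  | sup K L _ _ ihK ihL =>
    obtain ⟨k, hk⟩ := ihK fun z hz ↦ h (Ideal.mem_sup_left hz)
    obtain ⟨l, hl⟩ := ihL fun z hz ↦ h (Ideal.mem_sup_right hz)
    exact ⟨k + l, sup_pow_le_pow_sub hk hl⟩

theorem mul_pow_mul_sup_span_pow_le {I : Ideal R} {c z : R} (h : ∀ n, c * z ^ n ∈ I ^ n) (n : ℕ) :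
    ∀ m, span {c * z ^ m} * (I ⊔ span {z}) ^ n ≤ I ^ (n + m) := by
  induction n with
  | zero => intro m; simpa [span_singleton_le_iff_mem] using h m
  | succ n ih =>
    intro m
    have h1 : span {c * z ^ m} * (I ⊔ span {z}) ^ (n + 1) =
        span {c * z ^ m} * (I ⊔ span {z}) ^ n * I ⊔
          span {c * z ^ (m + 1)} * (I ⊔ span {z}) ^ n := by
      rw [pow_succ z, ← mul_assoc, ← span_singleton_mul_span_singleton (c * z ^ m),
        ← Ideal.add_eq_sup, ← Ideal.add_eq_sup]
      ring
    rw [h1]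
    refine sup_le ?_ ((ih (m + 1)).trans (Ideal.pow_le_pow_right (by omega)))
    rw [show n + 1 + m = n + m + 1 by omega, pow_succ]
    exact Ideal.mul_mono_left (ih m)

theorem mem_intCl_of_mul_pow_mem_of_isDomain [IsNoetherianRing R] [IsDomain R] {I : Ideal R}
    {c z : R} (hc : c ≠ 0) (h : ∀ n, c * z ^ n ∈ I ^ n) : z ∈ intCl I := by
  rw [mem_intCl_iff]
  set J := I ⊔ span {z}
  let F : I.Filtration R :=
    { N := fun n ↦ span {c} * J ^ n
      mono := fun i ↦ Ideal.mul_mono_right (Ideal.pow_le_pow_right i.le_succ)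
      smul_le := fun i ↦ by
        rw [smul_eq_mul, pow_succ', mul_left_comm]
        exact Ideal.mul_mono_right (Ideal.mul_mono_left le_sup_left) }
  have hF : F ≤ I.stableFiltration ⊤ := by
    intro n
    change span {c} * J ^ n ≤ I ^ n * ⊤
    rw [Ideal.mul_top]
    simpa using mul_pow_mul_sup_span_pow_le h n 0
  obtain ⟨n, hn⟩ := (I.stableFiltration_stable ⊤).of_le hF
  refine ⟨n, ?_⟩
  have h1 : I * (span {c} * J ^ n) = span {c} * J ^ (n + 1) := hn n le_rfl
  rw [mul_left_comm] at h1
  rw [(Ideal.span_singleton_mul_right_inj hc).1 h1]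
  exact Ideal.pow_mem_pow (Ideal.mem_sup_right (mem_span_singleton_self z)) _

theorem exists_pow_mem_sup_mul {I A B : Ideal R} {z : R}
    (hA : ∃ n, z ^ (n + 1) ∈ I * (I ⊔ span {z}) ^ n ⊔ A)
    (hB : ∃ n, z ^ (n + 1) ∈ I * (I ⊔ span {z}) ^ n ⊔ B) :
    ∃ n, z ^ (n + 1) ∈ I * (I ⊔ span {z}) ^ n ⊔ A * B := by
  obtain ⟨n, hn⟩ := hA
  obtain ⟨m, hm⟩ := hB
  set J := I ⊔ span {z}
  have hz : ∀ k, z ^ k ∈ J ^ k :=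
    Ideal.pow_mem_pow (Ideal.mem_sup_right (mem_span_singleton_self z))
  have hIJ : ∀ k, I * J ^ k ≤ J ^ (k + 1) := fun k ↦ by
    rw [pow_succ']
    exact Ideal.mul_mono_left le_sup_left
  obtain ⟨u, hu, a, ha, hua⟩ := Submodule.mem_sup.1 hn
  obtain ⟨v, hv, b, hb, hvb⟩ := Submodule.mem_sup.1 hm
  refine ⟨n + m + 1, ?_⟩
  have h : z ^ (n + m + 1 + 1) = (u * z ^ (m + 1) + v * (z ^ (n + 1) - u)) + a * b := by
    rw [show n + m + 1 + 1 = (n + 1) + (m + 1) by omega, pow_add, ← hua, ← hvb]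
    ring
  rw [h]
  refine Submodule.add_mem_sup (Ideal.add_mem _ ?_ ?_) (Ideal.mul_mem_mul ha hb)
  · rw [show n + m + 1 = n + (m + 1) by omega, pow_add, ← mul_assoc]
    exact Ideal.mul_mem_mul hu (hz _)
  · rw [show n + m + 1 = m + (n + 1) by omega, pow_add, ← mul_assoc]
    exact Ideal.mul_mem_mul hv (sub_mem (hz _) (hIJ _ hu))

/-- Integrality over an ideal of a Noetherian ring can be checked modulo the minimal primes. -/
theorem mem_intCl_of_forall_minimalPrimes [IsNoetherianRing R] {I : Ideal R} {z : R}
    (h : ∀ P ∈ minimalPrimes R, Ideal.Quotient.mk P z ∈ intCl (I.map (Ideal.Quotient.mk P))) :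
    z ∈ intCl I := by
  have hprime : ∀ P : Ideal R, P.IsPrime → ∃ n, z ^ (n + 1) ∈ I * (I ⊔ span {z}) ^ n ⊔ P := by
    intro P hP
    obtain ⟨Q, hQ, hQP⟩ := Ideal.exists_minimalPrimes_le (bot_le : (⊥ : Ideal R) ≤ P)
    obtain ⟨n, hn⟩ := mem_intCl_iff.1 (h Q hQ)
    refine ⟨n, sup_le_sup_left hQP _ ?_⟩
    rwa [← Ideal.mem_quotient_iff_mem_sup, map_pow, Ideal.map_mul, Ideal.map_pow, Ideal.map_sup,
      Ideal.map_span, Set.image_singleton]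
  obtain ⟨Z, hZ⟩ := PrimeSpectrum.exists_primeSpectrum_prod_le R (⊥ : Ideal R)
  have hprod : ∃ n, z ^ (n + 1) ∈
      I * (I ⊔ span {z}) ^ n ⊔ (Z.map PrimeSpectrum.asIdeal).prod := by
    clear hZ
    induction Z using Multiset.induction with
    | empty => exact ⟨0, by simp⟩
    | cons P Z ih =>
      rw [Multiset.map_cons, Multiset.prod_cons]
      exact exists_pow_mem_sup_mul (hprime _ P.isPrime) ih
  rw [mem_intCl_iff]
  simpa [le_bot_iff.1 hZ] using hprod

/-- The asymptotic criterion for integrality over an ideal. -/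
theorem mem_intCl_of_mul_pow_mem [IsNoetherianRing R] {I : Ideal R}
    (hI : ∃ d ∈ Rcirc R, d ∈ I) {c z : R} (hc : c ∈ Rcirc R) {N : ℕ}
    (h : ∀ n, N ≤ n → c * z ^ n ∈ I ^ n) : z ∈ intCl I := by
  obtain ⟨d, hd, hdI⟩ := hI
  refine mem_intCl_of_forall_minimalPrimes fun P hP ↦ ?_
  have : P.IsPrime := hP.1.1
  refine mem_intCl_of_mul_pow_mem_of_isDomain (c := Ideal.Quotient.mk P (c * d ^ N)) ?_ fun n ↦ ?_
  · rw [Ne, Ideal.Quotient.eq_zero_iff_mem]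
    exact mul_mem_Rcirc hc (pow_mem_Rcirc hd N) P hP
  · rw [← map_pow, ← map_mul, ← Ideal.map_pow]
    refine Ideal.mem_map_of_mem _ ?_
    rcases le_total N n with hn | hn
    · rw [mul_right_comm]
      exact Ideal.mul_mem_right _ _ (h n hn)
    · rw [mul_right_comm]
      exact Ideal.mul_mem_left _ _ (Ideal.pow_le_pow_right hn (Ideal.pow_mem_pow hdI N))

end IntegralClosure

theorem HY_integral_closure_integer_t {R : Type*} [CommRing R] [IsNoetherianRing R]
    (I a : Ideal R) (hI : ∃ c ∈ Rcirc R, c ∈ I) (ha : ∃ c ∈ Rcirc R, c ∈ a)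
    (t : ℕ) (ht : 1 ≤ t) :
    HYIntCl I a (t : ℝ) = {x | ∀ y ∈ a ^ t, x * y ∈ intCl I} := by
  have hceil : ∀ n : ℕ, ⌈(t : ℝ) * (n : ℝ)⌉₊ = t * n := fun n ↦ by
    rw [← Nat.cast_mul, Nat.ceil_natCast]
  ext x
  simp only [HYIntCl, Set.mem_ofPred_eq, hceil, pow_mul]
  constructor
  · rintro ⟨c, hc, N, h⟩ y hy
    refine mem_intCl_of_mul_pow_mem hI hc (N := N) fun n hn ↦ ?_
    rw [mul_pow, ← mul_assoc]
    exact h n hn _ (Ideal.pow_mem_pow hy n)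
  · intro h
    obtain ⟨k, hk⟩ := exists_pow_le_of_subset_intCl (I := I) (K := span {x} * a ^ t)
      (IsNoetherian.noetherian _) (by
        intro z hz
        obtain ⟨y, hy, rfl⟩ := Ideal.mem_span_singleton_mul.1 hz
        exact h y hy)
    obtain ⟨d, hd, hdI⟩ := hI
    refine ⟨d ^ k, pow_mem_Rcirc hd k, 0, fun n _ y hy ↦ ?_⟩
    have hxy : x ^ n * y ∈ I ^ (n - k) := by
      refine hk n ?_
      rw [mul_pow]
      exact Ideal.mul_mem_mul (Ideal.pow_mem_pow (mem_span_singleton_self x) n) hy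
    have := Ideal.mul_mem_mul (Ideal.pow_mem_pow hdI k) hxy
    rw [← pow_add, ← mul_assoc] at this
    exact Ideal.pow_le_pow_right (by omega) this
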